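/- Let ι be an index set and let X ⊆ [0,1]^ι be a nonempty closed set (in the product topology) which is a topological manifold without boundary, i.e., for some fixed k ≥ 0 every point of X has an open neighborhood in X homeomorphic to ℝ^k. Then McN(X) is hopfian: every surjective MV-endomorphism of McN(X) is injective. (This is the concrete form of the statement that every semisimple MV-algebra whose maximal spectral space is a manifold without boundary is hopfian.) -/

import Mathlib

open Set BigOperators

/-- The unit cube `[0,1]^n` as a subset of `Fin n → ℝ`. -/
def cube (n : ℕ) : Set (Fin n → ℝ) := Set.Icc 0 1

/-- An (affine) linear polynomial with integer coefficients. -/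
def IsAffineZ {n : ℕ} (p : (Fin n → ℝ) → ℝ) : Prop :=
  ∃ (m : ℤ) (c : Fin n → ℤ), ∀ x, p x = (m : ℝ) + ∑ i, (c i : ℝ) * x i

/-- A McNaughton function on `[0,1]^n`: continuous, `[0,1]`-valued, and agreeing at each
point of the cube with one of finitely many affine polynomials with integer coefficients. -/
def IsMcNaughton {n : ℕ} (f : (Fin n → ℝ) → ℝ) : Prop :=
  ContinuousOn f (cube n) ∧ (∀ x ∈ cube n, f x ∈ Set.Icc (0:ℝ) 1) ∧
  ∃ (u : ℕ) (p : Fin u → (Fin n → ℝ) → ℝ),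
    (∀ j, IsAffineZ (p j)) ∧ ∀ x ∈ cube n, ∃ j, f x = p j x

/-- `McN X`: restrictions to `X` of McNaughton functions on `[0,1]^n`. -/
def McN {n : ℕ} (X : Set (Fin n → ℝ)) : Set (↥X → ℝ) :=
  {g : ↥X → ℝ | ∃ f, IsMcNaughton (n := n) f ∧ ∀ x : X, g x = f x.1}

/-- Pointwise MV-negation `¬f = 1 - f`. -/
def mvNeg {α : Type*} (f : α → ℝ) : α → ℝ := fun x => 1 - f x

/-- Pointwise MV-sum `f ⊕ g = min(1, f + g)`. -/
def mvOplus {α : Type*} (f g : α → ℝ) : α → ℝ := fun x => min 1 (f x + g x)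

/-- A point all of whose coordinates are rational. -/
def IsRationalPoint {n : ℕ} (x : Fin n → ℝ) : Prop := ∀ i, ∃ q : ℚ, x i = (q : ℝ)

/-- An MV-endomorphism of `McN X`. -/
def IsMVEndo {n : ℕ} (X : Set (Fin n → ℝ)) (σ : (↥X → ℝ) → (↥X → ℝ)) : Prop :=
  Set.MapsTo σ (McN X) (McN X) ∧
  σ (fun _ => 0) = (fun _ => 0) ∧
  (∀ f ∈ McN X, σ (mvNeg f) = mvNeg (σ f)) ∧
  (∀ f ∈ McN X, ∀ g ∈ McN X, σ (mvOplus f g) = mvOplus (σ f) (σ g))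

/-- The cube `[0,1]^ι` for an arbitrary index set `ι`. -/
def cubeI (ι : Type*) : Set (ι → ℝ) := Set.Icc 0 1

/-- A McNaughton function on `[0,1]^ι`: it depends on finitely many coordinates, through a
McNaughton function on a finite-dimensional cube. -/
def IsMcNaughtonI {ι : Type*} (g : (ι → ℝ) → ℝ) : Prop :=
  ∃ (m : ℕ) (e : Fin m → ι) (f : (Fin m → ℝ) → ℝ),
    IsMcNaughton (n := m) f ∧ ∀ x ∈ cubeI ι, g x = f (fun j => x (e j))

/-- `McNI X`: restrictions to `X ⊆ [0,1]^ι` of McNaughton functions on `[0,1]^ι`. -/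
def McNI {ι : Type*} (X : Set (ι → ℝ)) : Set (↥X → ℝ) :=
  {g : ↥X → ℝ | ∃ f, IsMcNaughtonI (ι := ι) f ∧ ∀ x : X, g x = f x.1}

/-- An MV-endomorphism of `McNI X`. -/
def IsMVEndoI {ι : Type*} (X : Set (ι → ℝ)) (σ : (↥X → ℝ) → (↥X → ℝ)) : Prop :=
  Set.MapsTo σ (McNI X) (McNI X) ∧
  σ (fun _ => 0) = (fun _ => 0) ∧
  (∀ f ∈ McNI X, σ (mvNeg f) = mvNeg (σ f)) ∧
  (∀ f ∈ McNI X, ∀ g ∈ McNI X, σ (mvOplus f g) = mvOplus (σ f) (σ g))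

section Topology

open Metric MeasureTheory Filter Topology

/-- The determinant of `1 + A` is a fixed linear combination of determinants `det (1 + t • A)` with
`t` arbitrarily small. -/
theorem exists_det_one_add_smul_interpolation {E : Type*} [NormedAddCommGroup E] [NormedSpace ℝ E]
    [FiniteDimensional ℝ E] {t₀ : ℝ} (ht₀ : 0 < t₀) :
    ∃ (n : ℕ) (t w : Fin n → ℝ), (∀ j, t j ∈ Ioc 0 t₀) ∧ ∑ j, w j = 1 ∧
      ∀ A : E →L[ℝ] E, (1 + A).det = ∑ j, w j * (1 + t j • A).det := by
  classical
  set d := Module.finrank ℝ E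
  set t : Fin (d + 1) → ℝ := fun j => t₀ / (j + 1)
  have ht_inj : InjOn t (Finset.univ : Finset (Fin (d + 1))) := by
    intro i _ j _ h
    have hi : (0 : ℝ) < (i : ℝ) + 1 := by positivity
    have hj : (0 : ℝ) < (j : ℝ) + 1 := by positivity
    have : (j : ℝ) + 1 = (i : ℝ) + 1 := by
      simp only [t] at h
      field_simp at h
      linarith
    exact Fin.ext (by exact_mod_cast (add_right_cancel this).symm)
  have hinterp : ∀ p : Polynomial ℝ, p.natDegree ≤ d →
      p.eval 1 = ∑ j, (Lagrange.basis Finset.univ t j).eval 1 * p.eval (t j) := by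
    intro p hp
    have hlt : p.degree < (Finset.univ : Finset (Fin (d + 1))).card := by
      rw [Finset.card_univ, Fintype.card_fin]
      exact lt_of_le_of_lt Polynomial.degree_le_natDegree (by exact_mod_cast Nat.lt_succ_of_le hp)
    conv_lhs => rw [Lagrange.eq_interpolate ht_inj hlt]
    simp [Lagrange.interpolate_apply, Polynomial.eval_finsetSum, mul_comm]
  refine ⟨d + 1, t, fun j => (Lagrange.basis Finset.univ t j).eval 1, fun j => ⟨by positivity, ?_⟩,
    ?_, fun A => ?_⟩
  · exact div_le_self ht₀.le (by simp)
  · simpa using (hinterp 1 (by simp)).symm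
  · let b := Module.finBasis ℝ E
    let M := LinearMap.toMatrix b b (A : E →ₗ[ℝ] E)
    let p : Polynomial ℝ :=
      ((Polynomial.X : Polynomial ℝ) • M.map Polynomial.C + (1 : Matrix _ _ ℝ).map Polynomial.C).det
    have hp : p.natDegree ≤ d :=
      (Polynomial.natDegree_det_X_add_C_le M (1 : Matrix _ _ ℝ)).trans (by simp [d])
    have hev : ∀ s : ℝ, p.eval s = (1 + s • A).det := by
      intro s
      rw [ContinuousLinearMap.det, ← LinearMap.det_toMatrix b, ← Polynomial.coe_evalRingHom,
        RingHom.map_det]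
      congr 1
      ext i j
      simp [M, LinearMap.toMatrix_apply, Matrix.one_apply, Finsupp.single_apply, apply_ite, eq_comm,
        add_comm]
      exact mul_comm _ _
    have := hinterp p hp
    simp only [hev, one_smul] at this
    exact this

/-- There is no `C¹` retraction of the closed unit ball onto the unit sphere. -/
theorem not_contDiff_retraction_sphere {E : Type*} [NormedAddCommGroup E] [InnerProductSpace ℝ E]
    [FiniteDimensional ℝ E] {r : E → E} (hr : ContDiff ℝ 1 r) (hnorm : ∀ x, ‖r x‖ = 1)
    (hfix : ∀ x, ‖x‖ = 1 → r x = x) : False := by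
  borelize E
  set A : E → E →L[ℝ] E := fun x => fderiv ℝ r x - 1 with hA
  have hAc : Continuous A := (hr.continuous_fderiv one_ne_zero).sub continuous_const
  have hdet0 : ∀ x, (1 + A x).det = 0 := by
    intro x
    have hd : HasFDerivAt r (fderiv ℝ r x) x := (hr.differentiable one_ne_zero x).hasFDerivAt
    have horth : ∀ v, inner ℝ (r x) (fderiv ℝ r x v) = 0 := by
      intro v
      have h1 := hd.norm_sq
      have h2 : HasFDerivAt (fun y => ‖r y‖ ^ 2) (0 : E →L[ℝ] ℝ) x := by
        simp only [hnorm]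
        exact hasFDerivAt_const _ _
      have := congrArg (fun L => L v) (h1.unique h2)
      simpa using this
    by_contra hne
    have hsurj : Function.Surjective (fderiv ℝ r x) := by
      have : IsUnit (LinearMap.det ((fderiv ℝ r x : E →L[ℝ] E) : E →ₗ[ℝ] E)) := by
        rw [isUnit_iff_ne_zero]
        simpa [hA, ContinuousLinearMap.det] using hne
      exact ((LinearMap.equivOfDetNeZero _ this.ne_zero).surjective)
    obtain ⟨v, hv⟩ := hsurj (r x)
    have h0 := horth v
    rw [hv, real_inner_self_eq_norm_sq, hnorm] at h0
    norm_num at h0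
  obtain ⟨δ, hδ, hdet⟩ : ∃ δ > 0, ∀ B : E →L[ℝ] E, ‖B‖ < δ → 0 < (1 + B).det := by
    have hc : ContinuousAt (fun B : E →L[ℝ] E => (1 + B).det) 0 :=
      (ContinuousLinearMap.continuous_det.comp (continuous_const.add continuous_id)).continuousAt
    have h1 : (0 : ℝ) < (1 + (0 : E →L[ℝ] E)).det := by simp [ContinuousLinearMap.det]
    obtain ⟨δ, hδ, h⟩ := Metric.eventually_nhds_iff.1 (hc.eventually (lt_mem_nhds h1))
    exact ⟨δ, hδ, fun B hB => h (by simpa using hB)⟩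
  obtain ⟨L, hL⟩ : ∃ L : ℝ, ∀ x ∈ closedBall (0 : E) 1, ‖A x‖ ≤ L :=
    (isCompact_closedBall 0 1).exists_bound_of_continuousOn hAc.continuousOn
  have hL0 : 0 ≤ L := (norm_nonneg _).trans (hL 0 (by simp))
  have hudiff : ∀ x, HasFDerivAt (fun x => r x - x) (A x) x := fun x =>
    (hr.differentiable one_ne_zero x).hasFDerivAt.sub (hasFDerivAt_id x)
  have hulip : ∀ x ∈ closedBall (0 : E) 1, ∀ y ∈ closedBall (0 : E) 1,
      ‖(r y - y) - (r x - x)‖ ≤ L * ‖y - x‖ := fun x hx y hy =>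
    (convex_closedBall 0 1).norm_image_sub_le_of_norm_hasFDerivWithin_le
      (fun z _ => (hudiff z).hasFDerivWithinAt) hL hx hy
  set t₀ : ℝ := min (1 / 2) (min (1 / 2) (δ / 2) / (L + 1))
  have ht₀pos : 0 < t₀ := by positivity
  have hsmall : ∀ t ∈ Ioc 0 t₀, t < 1 ∧ t * L < 1 ∧ t * L < δ := by
    intro t ht
    have h1 : t ≤ min (1 / 2) (δ / 2) / (L + 1) := ht.2.trans (min_le_right _ _)
    rw [le_div_iff₀ (by positivity)] at h1
    have h2 := h1.trans (min_le_left _ _)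
    have h3 := h1.trans (min_le_right _ _)
    have := ht.1
    exact ⟨(ht.2.trans (min_le_left _ _)).trans_lt (by norm_num), by nlinarith, by nlinarith⟩
  have hvol : ∀ t ∈ Ioc 0 t₀, ∫ x in ball (0 : E) 1, (1 + t • A x).det =
      volume.real (ball (0 : E) 1) := by
    intro t ht
    obtain ⟨ht1, htL, htδ⟩ := hsmall t ht
    set g : E → E := fun x => x + t • (r x - x) with hg
    have hgd : ∀ x, HasStrictFDerivAt g (1 + t • A x) x := fun x =>
      (hasStrictFDerivAt_id x).add
        (((hr.hasStrictFDerivAt one_ne_zero).sub (hasStrictFDerivAt_id x)).const_smul t)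
    have hpos : ∀ x ∈ closedBall (0 : E) 1, 0 < (1 + t • A x).det := by
      intro x hx
      apply hdet
      rw [norm_smul, Real.norm_of_nonneg ht.1.le]
      exact (mul_le_mul_of_nonneg_left (hL x hx) ht.1.le).trans_lt htδ
    have hinj : InjOn g (closedBall 0 1) := by
      intro x hx y hy hxy
      have h1 : y - x = -(t • ((r y - y) - (r x - x))) := by
        simp only [hg] at hxy
        rw [smul_sub, neg_sub, sub_eq_sub_iff_add_eq_add, ← hxy, add_comm]
      have h2 : ‖y - x‖ ≤ (t * L) * ‖y - x‖ := by
        conv_lhs => rw [h1, norm_neg, norm_smul, Real.norm_of_nonneg ht.1.le]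
        rw [mul_assoc]
        exact mul_le_mul_of_nonneg_left (hulip x hx y hy) ht.1.le
      have h3 : ‖y - x‖ = 0 := by
        have := norm_nonneg (y - x)
        nlinarith
      exact (sub_eq_zero.1 (norm_eq_zero.1 h3)).symm
    have hmaps : g '' ball 0 1 ⊆ ball 0 1 := by
      rintro _ ⟨x, hx, rfl⟩
      rw [mem_ball_zero_iff] at hx ⊢
      have h1 : g x = (1 - t) • x + t • r x := by simp only [hg]; module
      rw [h1]
      refine (norm_add_le _ _).trans_lt ?_
      rw [norm_smul, norm_smul, hnorm, Real.norm_of_nonneg ht.1.le,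
        Real.norm_of_nonneg (by linarith)]
      nlinarith
    have hopen : IsOpen (g '' ball 0 1) := by
      rw [isOpen_iff_mem_nhds]
      rintro _ ⟨x, hx, rfl⟩
      have hsurj : (1 + t • A x : E →L[ℝ] E).range = ⊤ := by
        rw [LinearMap.range_eq_top]
        exact (LinearMap.equivOfDetNeZero _ (hpos x (ball_subset_closedBall hx)).ne').surjective
      rw [← (hgd x).map_nhds_eq_of_surj hsurj]
      exact image_mem_map (isOpen_ball.mem_nhds hx)
    have himage : g '' ball 0 1 = ball 0 1 := by
      refine hmaps.antisymm ?_
      refine (convex_ball (0 : E) 1).isPreconnected.subset_of_closure_inter_subset hopen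
        ⟨g 0, hmaps (mem_image_of_mem _ (by simp)), mem_image_of_mem _ (by simp)⟩ ?_
      rintro y ⟨hy, hyb⟩
      have hgc : Continuous g := continuous_iff_continuousAt.2 fun x => (hgd x).continuousAt
      have hcl : closure (g '' ball 0 1) ⊆ g '' closedBall 0 1 :=
        closure_minimal (image_mono ball_subset_closedBall)
          ((isCompact_closedBall 0 1).image hgc).isClosed
      obtain ⟨x, hx, rfl⟩ := hcl hy
      rcases lt_or_eq_of_le (mem_closedBall_zero_iff.1 hx) with h | h
      · exact mem_image_of_mem _ (mem_ball_zero_iff.2 h)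
      · exfalso
        rw [mem_ball_zero_iff] at hyb
        simp [hg, hfix x h, h] at hyb
    have hcov := integral_image_eq_integral_abs_det_fderiv_smul volume measurableSet_ball
      (fun x _ => (hgd x).hasFDerivAt.hasFDerivWithinAt) (hinj.mono ball_subset_closedBall)
      (fun _ => (1 : ℝ))
    rw [himage] at hcov
    simp only [smul_eq_mul, mul_one, integral_const, MeasurableSet.univ,
      measureReal_restrict_apply, univ_inter] at hcov
    rw [hcov]
    refine setIntegral_congr_fun measurableSet_ball fun x hx => ?_
    exact (abs_of_pos (hpos x (ball_subset_closedBall hx))).symm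
  obtain ⟨n, t, w, ht, hw, hA'⟩ := exists_det_one_add_smul_interpolation (E := E) ht₀pos
  have hintegrable : ∀ j, IntegrableOn (fun x => w j * (1 + t j • A x).det) (ball (0 : E) 1) := by
    intro j
    have hc : Continuous fun x => w j * (1 + t j • A x).det :=
      continuous_const.mul (ContinuousLinearMap.continuous_det.comp
        (continuous_const.add (hAc.const_smul (t j))))
    exact (hc.continuousOn.integrableOn_compact (isCompact_closedBall 0 1)).mono_set
      ball_subset_closedBall
  have h0 : ∫ x in ball (0 : E) 1, ∑ j, w j * (1 + t j • A x).det = 0 := by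
    simp only [← hA', hdet0, integral_zero]
  rw [integral_finsetSum _ (fun j _ => hintegrable j)] at h0
  simp only [integral_const_mul, hvol _ (ht _)] at h0
  rw [← Finset.sum_mul, hw, one_mul] at h0
  have : 0 < volume.real (ball (0 : E) 1) :=
    ENNReal.toReal_pos (measure_ball_pos _ _ one_pos).ne' measure_ball_lt_top.ne
  exact this.ne' h0

/-- A continuous map close to the identity on the closed unit ball has a zero there. -/
theorem exists_eq_zero_of_norm_sub_le {E : Type*} [NormedAddCommGroup E] [InnerProductSpace ℝ E]
    [FiniteDimensional ℝ E] {h : E → E} (hc : ContinuousOn h (closedBall 0 1))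
    (hid : ∀ x ∈ closedBall (0 : E) 1, ‖h x - x‖ ≤ 1 / 2) :
    ∃ x ∈ closedBall (0 : E) 1, h x = 0 := by
  by_contra! hne
  obtain ⟨h', hh'⟩ := ContinuousMap.exists_restrict_eq (Y := E)
    (isClosed_closedBall (x := (0 : E)) (ε := 1))
    ⟨(closedBall (0 : E) 1).domRestrict h, hc.domRestrict⟩
  have hext : ∀ x ∈ closedBall (0 : E) 1, h' x = h x := fun x hx =>
    congrArg (fun F => F ⟨x, hx⟩) hh'
  set χ : E → ℝ := fun x => max 0 (min 1 (5 * ‖x‖ - 3)) with hχ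
  have hχc : Continuous χ := by fun_prop
  set H₀ : E → E := fun x => χ x • x + (1 - χ x) • h' x with hH₀
  have hH₀c : Continuous H₀ :=
    (hχc.smul continuous_id).add ((continuous_const.sub hχc).smul h'.continuous)
  have hχ1 : ∀ x, 4 / 5 ≤ ‖x‖ → χ x = 1 := by
    intro x hx
    simp only [hχ]
    rw [min_eq_left (by linarith), max_eq_right zero_le_one]
  have hH₀id : ∀ x, 4 / 5 ≤ ‖x‖ → H₀ x = x := fun x hx => by simp [hH₀, hχ1 x hx]
  have hH₀ne : ∀ x, H₀ x ≠ 0 := by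
    intro x hx
    rcases le_total (4 / 5) ‖x‖ with h1 | h1
    · rw [hH₀id x h1] at hx
      rw [hx, norm_zero] at h1
      norm_num at h1
    · have hxB : x ∈ closedBall (0 : E) 1 := mem_closedBall_zero_iff.2 (by linarith)
      rcases le_total ‖x‖ (3 / 5) with h2 | h2
      · have : χ x = 0 := by
          simp only [hχ]
          exact max_eq_left ((min_le_right _ _).trans (by linarith))
        simp only [hH₀, this, hext x hxB, zero_smul, sub_zero, one_smul, zero_add] at hx
        exact hne x hxB hx
      · have hχ0 : 0 ≤ χ x := le_max_left _ _
        have hχle : χ x ≤ 1 := max_le zero_le_one (min_le_left _ _)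
        have h3 : x = -((1 - χ x) • (h x - x)) := by
          simp only [hH₀, hext x hxB] at hx
          rw [eq_neg_iff_add_eq_zero, ← hx]
          module
        have h4 : ‖x‖ ≤ 1 / 2 := by
          conv_lhs => rw [h3, norm_neg, norm_smul, Real.norm_of_nonneg (by linarith)]
          have := hid x hxB
          have := norm_nonneg (h x - x)
          nlinarith
        linarith
  have hopen : IsOpen {x : E | 4 / 5 < ‖x‖} := isOpen_lt continuous_const continuous_norm
  have hclosed : IsClosed {x : E | 9 / 10 ≤ ‖x‖} := isClosed_le continuous_const continuous_norm
  obtain ⟨H, hHc, hHd, hHeq, -⟩ := hH₀c.exists_contDiff_approx_and_eqOn 1 hH₀c.norm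
    (fun x => norm_pos_iff.2 (hH₀ne x)) hclosed (U := {x : E | 4 / 5 < ‖x‖})
    (hopen.mem_nhdsSet.2 fun x hx => by
      simp only [mem_ofPred_eq] at hx ⊢
      linarith)
    (contDiffOn_id.congr fun x hx => hH₀id x (le_of_lt hx))
  have hHne : ∀ x, H x ≠ 0 := by
    intro x hx
    have := hHd x
    simp [hx] at this
  have hHid : ∀ x, ‖x‖ = 1 → H x = x := fun x hx =>
    (hHeq (show 9 / 10 ≤ ‖x‖ by rw [hx]; norm_num)).trans (hH₀id x (by rw [hx]; norm_num))
  refine not_contDiff_retraction_sphere (r := fun x => ‖H x‖⁻¹ • H x)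
    (((hHc.norm ℝ hHne).inv fun x => norm_ne_zero_iff.2 (hHne x)).smul hHc)
    (fun x => ?_) fun x hx => ?_
  · rw [norm_smul, norm_inv, norm_norm, inv_mul_cancel₀ (norm_ne_zero_iff.2 (hHne x))]
  · simp [hHid x hx, hx]

/-- **Invariance of domain**, local form. -/
theorem image_closedBall_mem_nhds {E : Type*} [NormedAddCommGroup E] [InnerProductSpace ℝ E]
    [FiniteDimensional ℝ E] {f : E → E} (hc : ContinuousOn f (closedBall 0 1))
    (hinj : InjOn f (closedBall 0 1)) : f '' closedBall 0 1 ∈ 𝓝 (f 0) := by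
  borelize E
  set B : Set E := closedBall 0 1 with hB
  have hBc : IsCompact B := isCompact_closedBall 0 1
  have hzB : (0 : E) ∈ B := by simp [hB]
  have : CompactSpace B := isCompact_iff_compactSpace.1 hBc
  obtain ⟨G, hG⟩ := ContinuousMap.exists_extension' (Y := E)
    (hc.domRestrict.isClosedEmbedding hinj.injective) ⟨Subtype.val, continuous_subtype_val⟩
  have hGf : ∀ x ∈ B, G (f x) = x := fun x hx => congrFun hG ⟨x, hx⟩
  by_contra hnot
  obtain ⟨ρ, hρ, hGρ⟩ : ∃ ρ > 0, ∀ y, dist y (f 0) < ρ → ‖G y‖ < 1 / 10 := by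
    have h1 : ContinuousAt (fun y => ‖G y‖) (f 0) := G.continuous.norm.continuousAt
    have h2 : ‖G (f 0)‖ < 1 / 10 := by rw [hGf 0 hzB]; norm_num
    obtain ⟨ρ, hρ, h⟩ := Metric.eventually_nhds_iff.1 (h1.eventually (gt_mem_nhds h2))
    exact ⟨ρ, hρ, fun y hy => h hy⟩
  set ε := ρ / 3 with hε
  have hεpos : 0 < ε := by positivity
  obtain ⟨c, hcε, hcK⟩ : ∃ c, dist c (f 0) < ε ∧ c ∉ f '' B := by
    by_contra! hcon
    exact hnot (mem_of_superset (ball_mem_nhds _ hεpos) fun c hc => hcon c hc)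
  have hGsmall : ∀ y, dist y c ≤ ε → ‖G y‖ < 1 / 10 := fun y hy =>
    hGρ y (by linarith [dist_triangle y c (f 0)])
  have hfne : ∀ x ∈ B, f x - c ≠ 0 := fun x hx h =>
    hcK ⟨x, hx, sub_eq_zero.1 h⟩
  obtain ⟨δ, hδ, hGδ⟩ : ∃ δ > 0, ∀ y ∈ f '' B ∩ {y | ε ≤ dist y c}, δ ≤ ‖G y‖ := by
    have hcpt : IsCompact (f '' B ∩ {y | ε ≤ dist y c}) :=
      (hBc.image_of_continuousOn hc).inter_right
        (isClosed_le continuous_const (continuous_id.dist continuous_const))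
    refine hcpt.exists_forall_le' G.continuous.norm.continuousOn ?_
    rintro _ ⟨⟨x, hx, rfl⟩, hxc⟩
    rw [hGf x hx, norm_pos_iff]
    rintro rfl
    rw [mem_ofPred_eq, dist_comm] at hxc
    linarith
  set η := min δ (1 / 10)
  have hηpos : 0 < η := by positivity
  obtain ⟨P, hPc, hPG, -⟩ := G.continuous.exists_contDiff_approx 1
    (continuous_const (y := η / 2)) (fun _ => by positivity)
  obtain ⟨v, hv, hvP⟩ : ∃ v ∈ ball (0 : E) (η / 2), v ∉ P '' sphere c ε := by
    by_contra! hcon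
    have h1 : volume (P '' sphere c ε) = 0 :=
      addHaar_image_eq_zero_of_differentiableOn_of_addHaar_eq_zero _
        (hPc.differentiable one_ne_zero).differentiableOn
        (Measure.addHaar_sphere_of_ne_zero _ _ hεpos.ne')
    exact (measure_ball_pos volume (0 : E) (half_pos hηpos)).ne' (measure_mono_null hcon h1)
  rw [mem_ball_zero_iff] at hv
  have hdist : ∀ y, ‖(P y - v) - G y‖ < η := by
    intro y
    have h1 := hPG y
    rw [dist_eq_norm] at h1
    calc ‖(P y - v) - G y‖ = ‖(P y - G y) - v‖ := by congr 1; abel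
      _ ≤ ‖P y - G y‖ + ‖v‖ := norm_sub_le _ _
      _ < η := by linarith
  set Φ : E → E := fun x => c + max (ε / ‖f x - c‖) 1 • (f x - c) with hΦ
  have hΦc : ContinuousOn Φ B := by
    have h1 : ContinuousOn (fun x => f x - c) B := hc.sub continuousOn_const
    exact continuousOn_const.add
      (((continuousOn_const.div h1.norm fun x hx => norm_ne_zero_iff.2 (hfne x hx)).sup
        continuousOn_const).smul h1)
  have hΦfar : ∀ x ∈ B, ε ≤ dist (f x) c → Φ x = f x := by
    intro x hx h
    rw [dist_eq_norm] at h
    have : ε / ‖f x - c‖ ≤ 1 := div_le_one_of_le₀ h (norm_nonneg _)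
    simp [hΦ, max_eq_right this]
  have hΦnear : ∀ x ∈ B, dist (f x) c ≤ ε → Φ x ∈ sphere c ε := by
    intro x hx h
    have hpos := norm_pos_iff.2 (hfne x hx)
    rw [dist_eq_norm] at h
    have h1 : 1 ≤ ε / ‖f x - c‖ := (one_le_div hpos).2 h
    rw [mem_sphere, dist_eq_norm]
    simp only [hΦ, max_eq_left h1, add_sub_cancel_left]
    rw [norm_smul, Real.norm_of_nonneg (by positivity)]
    field_simp
  obtain ⟨x, hx, hx0⟩ := exists_eq_zero_of_norm_sub_le (h := fun x => P (Φ x) - v)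
    ((hPc.continuous.comp_continuousOn hΦc).sub continuousOn_const) (by
      intro x hx
      rcases le_total ε (dist (f x) c) with h | h
      · have h1 := hdist (f x)
        simp only [hΦfar x hx h]
        rw [hGf x hx] at h1
        linarith [min_le_right δ (1 / 10)]
      · have h1 := hdist (Φ x)
        have h2 := hGsmall (Φ x) (hΦnear x hx h).le
        have h3 := hGsmall (f x) h
        rw [hGf x hx] at h3
        have h4 : P (Φ x) - v - x = ((P (Φ x) - v) - G (Φ x)) + G (Φ x) - x := by abel
        rw [h4]
        linarith [min_le_right δ (1 / 10), norm_sub_le ((P (Φ x) - v) - G (Φ x) + G (Φ x)) x,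
          norm_add_le ((P (Φ x) - v) - G (Φ x)) (G (Φ x))])
  rcases le_total ε (dist (f x) c) with h | h
  · have h1 := hdist (f x)
    simp only [hΦfar x hx h] at hx0
    rw [hx0, zero_sub, norm_neg] at h1
    linarith [hGδ (f x) ⟨mem_image_of_mem f hx, h⟩, min_le_left δ (1 / 10)]
  · exact hvP ⟨Φ x, hΦnear x hx h, sub_eq_zero.1 hx0⟩

/-- **Invariance of domain** for spaces covered by open embeddings of a fixed Euclidean space. -/
theorem isOpenMap_of_continuous_injective {E X Y : Type*} [NormedAddCommGroup E]
    [InnerProductSpace ℝ E] [FiniteDimensional ℝ E] [TopologicalSpace X] [TopologicalSpace Y]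
    (hX : ∀ x : X, ∃ a : E → X, IsOpenEmbedding a ∧ x ∈ range a)
    (hY : ∀ y : Y, ∃ b : E → Y, IsOpenEmbedding b ∧ y ∈ range b)
    {φ : X → Y} (hc : Continuous φ) (hinj : Function.Injective φ) : IsOpenMap φ := by
  rw [isOpenMap_iff_nhds_le]
  intro x N hN
  obtain ⟨a, ha, p, rfl⟩ := hX x
  obtain ⟨b, hb, q, hq⟩ := hY (φ (a p))
  let b' := hb.toOpenPartialHomeomorph b
  have hbb' : ∀ y ∈ range b, b (b'.symm y) = y := fun y hy => b'.right_inv (by simpa [b'] using hy)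
  have hmem : (φ ∘ a) ⁻¹' range b ∩ a ⁻¹' (φ ⁻¹' N) ∈ 𝓝 p :=
    inter_mem ((hc.comp ha.continuous).continuousAt (hb.isOpen_range.mem_nhds ⟨q, hq⟩))
      (ha.continuous.continuousAt hN)
  obtain ⟨r, hr, hball⟩ := Metric.nhds_basis_closedBall.mem_iff.1 hmem
  have hin : ∀ z ∈ closedBall (0 : E) 1, p + r • z ∈ closedBall p r := by
    intro z hz
    rw [mem_closedBall_zero_iff] at hz
    rw [mem_closedBall, dist_eq_norm, add_sub_cancel_left, norm_smul, Real.norm_of_nonneg hr.le]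
    exact mul_le_of_le_one_right hr.le hz
  set f : E → E := fun z => b'.symm (φ (a (p + r • z))) with hf
  have hbf : ∀ z ∈ closedBall (0 : E) 1, b (f z) = φ (a (p + r • z)) := fun z hz =>
    hbb' _ (hball (hin z hz)).1
  have hfc : ContinuousOn f (closedBall 0 1) := by
    refine b'.continuousOn_symm.comp (t := b'.target) (Continuous.continuousOn ?_) fun z hz => ?_
    · exact hc.comp (ha.continuous.comp (by fun_prop))
    · simpa [b'] using (hball (hin z hz)).1
  have hfinj : InjOn f (closedBall 0 1) := by
    intro z hz w hw hzw
    have h1 : φ (a (p + r • z)) = φ (a (p + r • w)) := by rw [← hbf z hz, hzw, hbf w hw]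
    exact smul_right_injective E hr.ne' (add_left_cancel (ha.injective (hinj h1)))
  have h0 : b (f 0) = φ (a p) := by simpa using hbf 0 (by simp)
  have h1 : b '' (f '' closedBall 0 1) ∈ 𝓝 (φ (a p)) := by
    rw [← h0]
    exact hb.isOpenMap.image_mem_nhds (image_closedBall_mem_nhds hfc hfinj)
  refine mem_of_superset h1 ?_
  rintro _ ⟨_, ⟨z, hz, rfl⟩, rfl⟩
  rw [hbf z hz]
  exact (hball (hin z hz)).2

theorem locallyConnectedSpace_of_isOpenEmbedding {E X : Type*} [TopologicalSpace E]
    [LocallyConnectedSpace E] [TopologicalSpace X]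
    (hX : ∀ x : X, ∃ a : E → X, IsOpenEmbedding a ∧ x ∈ range a) : LocallyConnectedSpace X := by
  rw [locallyConnectedSpace_iff_connected_subsets]
  intro x U hU
  obtain ⟨a, ha, p, rfl⟩ := hX x
  obtain ⟨V, hV, hVc, hVU⟩ := locallyConnectedSpace_iff_connected_subsets.1 ‹_› p (a ⁻¹' U)
    (ha.continuous.continuousAt hU)
  exact ⟨a '' V, ha.isOpenMap.image_mem_nhds hV, hVc.image a ha.continuous.continuousOn,
    image_subset_iff.2 hVU⟩

/-- An injective continuous map which is open and closed permutes the connected components of a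
compact locally connected space. -/
theorem surjective_of_isOpenMap_isClosedMap {X : Type*} [TopologicalSpace X] [CompactSpace X]
    [LocallyConnectedSpace X] {φ : X → X} (hc : Continuous φ) (hinj : Function.Injective φ)
    (hopen : IsOpenMap φ) (hclosed : IsClosedMap φ) : Function.Surjective φ := by
  have himage : ∀ x, connectedComponent (φ x) = φ '' connectedComponent x := by
    intro x
    refine Subset.antisymm ?_ (hc.image_connectedComponent_subset x)
    have hclopen : IsClopen (φ '' connectedComponent x) :=
      ⟨hclosed _ isClosed_connectedComponent, hopen _ isOpen_connectedComponent⟩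
    exact hclopen.connectedComponent_subset (mem_image_of_mem φ mem_connectedComponent)
  have : DiscreteTopology (ConnectedComponents X) := by
    rw [discreteTopology_iff_isOpen_singleton]
    intro c
    obtain ⟨x, rfl⟩ := ConnectedComponents.surjective_coe c
    rw [← ConnectedComponents.isQuotientMap_coe.isOpen_preimage,
      connectedComponents_preimage_singleton]
    exact isOpen_connectedComponent
  have hfin : Finite (ConnectedComponents X) := finite_of_compact_of_discrete
  have hmap_inj : Function.Injective hc.connectedComponentsMap := by
    intro c d hcd
    obtain ⟨x, rfl⟩ := ConnectedComponents.surjective_coe c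
    obtain ⟨y, rfl⟩ := ConnectedComponents.surjective_coe d
    have h1 : connectedComponent (φ x) = connectedComponent (φ y) :=
      ConnectedComponents.coe_eq_coe.1 hcd
    have h2 : φ y ∈ φ '' connectedComponent x := by
      rw [← himage, h1]
      exact mem_connectedComponent
    rw [hinj.mem_set_image] at h2
    exact (ConnectedComponents.coe_eq_coe'.2 h2).symm
  intro z
  obtain ⟨c, hcz⟩ := Finite.surjective_of_injective hmap_inj (z : ConnectedComponents X)
  obtain ⟨x, rfl⟩ := ConnectedComponents.surjective_coe c
  have h1 : connectedComponent (φ x) = connectedComponent z := ConnectedComponents.coe_eq_coe.1 hcz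
  have h2 : z ∈ φ '' connectedComponent x := by
    rw [← himage, h1]
    exact mem_connectedComponent
  exact image_subset_range _ _ h2

end Topology

/-- A set of `[0,1]`-valued functions closed under the pointwise MV-operations. -/
structure IsMVSubalgebra {α : Type*} (A : Set (α → ℝ)) : Prop where
  zero_mem : (fun _ => 0) ∈ A
  neg_mem : ∀ f ∈ A, mvNeg f ∈ A
  oplus_mem : ∀ f ∈ A, ∀ g ∈ A, mvOplus f g ∈ A
  mem_Icc : ∀ f ∈ A, ∀ x, f x ∈ Icc (0 : ℝ) 1

/-- An MV-homomorphism from `A` to the standard MV-algebra `[0,1]`. -/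
structure IsMVCharacter {α : Type*} (A : Set (α → ℝ)) (h : (α → ℝ) → ℝ) : Prop where
  map_zero : h (fun _ => 0) = 0
  map_neg : ∀ f ∈ A, h (mvNeg f) = 1 - h f
  map_oplus : ∀ f ∈ A, ∀ g ∈ A, h (mvOplus f g) = min 1 (h f + h g)
  mem_Icc : ∀ f ∈ A, h f ∈ Icc (0 : ℝ) 1

section MVAlgebra

variable {α : Type*} {A : Set (α → ℝ)}

theorem IsMVSubalgebra.eval (hA : IsMVSubalgebra A) (x : α) : IsMVCharacter A fun f => f x :=
  ⟨rfl, fun _ _ => rfl, fun _ _ _ _ => rfl, fun f hf => hA.mem_Icc f hf x⟩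

theorem IsMVCharacter.le_of_ker_le (hA : IsMVSubalgebra A) {h₁ h₂ : (α → ℝ) → ℝ}
    (H₁ : IsMVCharacter A h₁) (H₂ : IsMVCharacter A h₂)
    (hker : ∀ f ∈ A, h₁ f = 0 → h₂ f = 0) {f : α → ℝ} (hf : f ∈ A) : h₂ f ≤ h₁ f := by
  have key : ∀ n : ℕ, ∀ f ∈ A, 2 ^ n * (h₂ f - h₁ f) ≤ 1 := by
    intro n
    induction n with
    | zero =>
      intro f hf
      have := (H₁.mem_Icc f hf).1
      have := (H₂.mem_Icc f hf).2
      linarith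
    | succ n ih =>
      intro f hf
      rw [pow_succ, mul_assoc]
      have hnf := hA.neg_mem f hf
      have hdf := hA.oplus_mem _ hnf _ hnf
      have hsq : ∀ h : (α → ℝ) → ℝ, IsMVCharacter A h →
          h (mvNeg (mvOplus (mvNeg f) (mvNeg f))) = 1 - min 1 (2 - 2 * h f) := by
        intro h H
        rw [H.map_neg _ hdf, H.map_oplus _ hnf _ hnf, H.map_neg _ hf]
        ring_nf
      have h1 := (H₁.mem_Icc f hf).1
      have h2 := (H₂.mem_Icc f hf).2
      rcases le_or_gt (h₂ f) (1 / 2) with hb | hb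
      · have h3 := ih _ (hA.oplus_mem f hf f hf)
        rcases le_or_gt (h₁ f) (1 / 2) with ha | ha
        · rw [H₁.map_oplus _ hf _ hf, H₂.map_oplus _ hf _ hf, min_eq_right (by linarith),
            min_eq_right (by linarith)] at h3
          linarith
        · have : (0 : ℝ) < 2 ^ n := by positivity
          nlinarith
      · have h3 := ih _ (hA.neg_mem _ hdf)
        have h4 := hker _ (hA.neg_mem _ hdf)
        rw [hsq h₁ H₁, hsq h₂ H₂] at h3 h4
        rcases le_or_gt (1 / 2) (h₁ f) with ha | ha
        · rw [min_eq_right (by linarith), min_eq_right (by linarith)] at h3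
          linarith
        · rw [min_eq_left (by linarith), min_eq_right (by linarith)] at h4
          linarith [h4 (sub_self _)]
  by_contra! hlt
  obtain ⟨n, hn⟩ := pow_unbounded_of_one_lt (1 / (h₂ f - h₁ f)) (one_lt_two (α := ℝ))
  rw [div_lt_iff₀ (by linarith)] at hn
  linarith [key n f hf]

theorem IsMVCharacter.eq_of_ker_le (hA : IsMVSubalgebra A) {h₁ h₂ : (α → ℝ) → ℝ}
    (H₁ : IsMVCharacter A h₁) (H₂ : IsMVCharacter A h₂)
    (hker : ∀ f ∈ A, h₁ f = 0 → h₂ f = 0) {f : α → ℝ} (hf : f ∈ A) : h₁ f = h₂ f := by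
  have h1 := H₁.le_of_ker_le hA H₂ hker (hA.neg_mem f hf)
  rw [H₁.map_neg f hf, H₂.map_neg f hf] at h1
  linarith [H₁.le_of_ker_le hA H₂ hker hf]

/-- Every character of an MV-algebra of continuous functions on a compact space is an evaluation. -/
theorem IsMVCharacter.exists_eq_eval [TopologicalSpace α] [CompactSpace α]
    (hA : IsMVSubalgebra A) (hAc : ∀ f ∈ A, Continuous f) {h : (α → ℝ) → ℝ}
    (H : IsMVCharacter A h) : ∃ x, ∀ f ∈ A, h f = f x := by
  suffices hx : ∃ x, ∀ f ∈ A, h f = 0 → f x = 0 by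
    obtain ⟨x, hx⟩ := hx
    exact ⟨x, fun f hf => H.eq_of_ker_le hA (hA.eval x) hx hf⟩
  by_contra! hcon
  obtain ⟨f, hf, hf0, hfpos⟩ : ∃ f ∈ A, h f = 0 ∧ ∀ y ∈ (univ : Set α), 0 < f y := by
    refine isCompact_univ.induction_on (p := fun s => ∃ f ∈ A, h f = 0 ∧ ∀ y ∈ s, 0 < f y)
      ⟨_, hA.zero_mem, H.map_zero, by simp⟩ ?_ ?_ ?_
    · rintro s t hst ⟨f, hf, hf0, hfpos⟩
      exact ⟨f, hf, hf0, fun y hy => hfpos y (hst hy)⟩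
    · rintro s t ⟨f, hf, hf0, hfpos⟩ ⟨g, hg, hg0, hgpos⟩
      refine ⟨mvOplus f g, hA.oplus_mem f hf g hg, by simp [H.map_oplus f hf g hg, hf0, hg0], ?_⟩
      intro y hy
      refine lt_min one_pos ?_
      rcases hy with hy | hy
      · linarith [hfpos y hy, (hA.mem_Icc g hg y).1]
      · linarith [hgpos y hy, (hA.mem_Icc f hf y).1]
    · intro x _
      obtain ⟨f, hf, hf0, hfx⟩ := hcon x
      have hpos : 0 < f x := lt_of_le_of_ne (hA.mem_Icc f hf x).1 hfx.symm
      exact ⟨{y | 0 < f y}, mem_nhdsWithin_of_mem_nhds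
        ((isOpen_lt continuous_const (hAc f hf)).mem_nhds hpos), f, hf, hf0, fun y hy => hy⟩
  have key : ∀ n : ℕ, ∀ f ∈ A, h f = 0 → ¬ ∀ y, 1 ≤ 2 ^ n * f y := by
    intro n
    induction n with
    | zero =>
      intro f hf hf0 hle
      have hf1 : f = mvNeg fun _ => 0 := by
        funext y
        have := hle y
        have := (hA.mem_Icc f hf y).2
        simp only [mvNeg]
        linarith
      rw [hf1, H.map_neg _ hA.zero_mem, H.map_zero] at hf0
      norm_num at hf0
    | succ n ih =>
      intro f hf hf0 hle
      refine ih _ (hA.oplus_mem f hf f hf) (by simp [H.map_oplus f hf f hf, hf0]) fun y => ?_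
      have h1 : (1 : ℝ) ≤ 2 ^ n := one_le_pow₀ one_le_two
      have h2 := hle y
      rw [pow_succ, mul_assoc] at h2
      simp only [mvOplus]
      rcases min_choice 1 (f y + f y) with hm | hm <;> rw [hm] <;> linarith
  obtain ⟨δ, hδ, hfδ⟩ := isCompact_univ.exists_forall_le' (hAc f hf).continuousOn hfpos
  obtain ⟨n, hn⟩ := pow_unbounded_of_one_lt (1 / δ) (one_lt_two (α := ℝ))
  rw [div_lt_iff₀ hδ] at hn
  refine key n f hf hf0 fun y => hn.le.trans ?_
  exact mul_le_mul_of_nonneg_left (hfδ y (mem_univ y)) (by positivity)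

end MVAlgebra

section McNaughton

theorem IsAffineZ.const {n : ℕ} (m : ℤ) : IsAffineZ (n := n) fun _ => (m : ℝ) :=
  ⟨m, 0, by simp⟩

theorem IsAffineZ.proj {n : ℕ} (i : Fin n) : IsAffineZ fun x : Fin n → ℝ => x i :=
  ⟨0, Pi.single i 1, fun x => by simp [Pi.single_apply]⟩

theorem IsAffineZ.one_sub {n : ℕ} {p : (Fin n → ℝ) → ℝ} (hp : IsAffineZ p) :
    IsAffineZ fun x => 1 - p x := by
  obtain ⟨m, c, h⟩ := hp
  refine ⟨1 - m, -c, fun x => ?_⟩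
  simp only [h, Pi.neg_apply, Int.cast_sub, Int.cast_one, Int.cast_neg, neg_mul,
    Finset.sum_neg_distrib]
  ring

theorem IsAffineZ.add {n : ℕ} {p q : (Fin n → ℝ) → ℝ} (hp : IsAffineZ p) (hq : IsAffineZ q) :
    IsAffineZ fun x => p x + q x := by
  obtain ⟨m, c, h⟩ := hp
  obtain ⟨m', c', h'⟩ := hq
  refine ⟨m + m', c + c', fun x => ?_⟩
  simp only [h, h', Pi.add_apply, Int.cast_add, add_mul, Finset.sum_add_distrib]
  ring

theorem IsAffineZ.comp_index {m n : ℕ} {p : (Fin m → ℝ) → ℝ} (hp : IsAffineZ p)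
    (e : Fin m → Fin n) : IsAffineZ fun x => p (x ∘ e) := by
  obtain ⟨a, c, h⟩ := hp
  refine ⟨a, fun j => ∑ i with e i = j, c i, fun x => ?_⟩
  simp only [h, Int.cast_sum, Finset.sum_mul, Function.comp_apply]
  congr 1
  rw [← Finset.sum_fiberwise Finset.univ e]
  refine Finset.sum_congr rfl fun j _ => Finset.sum_congr rfl fun i hi => ?_
  rw [(Finset.mem_filter.1 hi).2]

theorem IsMcNaughton.of_finite {n : ℕ} {f : (Fin n → ℝ) → ℝ} {κ : Type*} [Finite κ]
    (hc : ContinuousOn f (cube n)) (hI : ∀ x ∈ cube n, f x ∈ Icc (0 : ℝ) 1)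
    (p : κ → (Fin n → ℝ) → ℝ) (hp : ∀ j, IsAffineZ (p j))
    (hfp : ∀ x ∈ cube n, ∃ j, f x = p j x) : IsMcNaughton f := by
  obtain ⟨u, ⟨e⟩⟩ := Finite.exists_equiv_fin κ
  refine ⟨hc, hI, u, fun j => p (e.symm j), fun j => hp _, fun x hx => ?_⟩
  obtain ⟨j, hj⟩ := hfp x hx
  exact ⟨e j, by simpa using hj⟩

theorem IsMcNaughton.zero {n : ℕ} : IsMcNaughton (n := n) fun _ => 0 :=
  .of_finite (κ := Unit) continuousOn_const (by simp) (fun _ _ => ((0 : ℤ) : ℝ))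
    (fun _ => .const 0) (by simp)

theorem IsMcNaughton.proj {n : ℕ} (i : Fin n) : IsMcNaughton fun x : Fin n → ℝ => x i :=
  .of_finite (κ := Unit) (continuous_apply i).continuousOn (fun _ hx => ⟨hx.1 i, hx.2 i⟩)
    (fun _ x => x i) (fun _ => .proj i) (by simp)

theorem IsMcNaughton.one_sub {n : ℕ} {f : (Fin n → ℝ) → ℝ} (hf : IsMcNaughton f) :
    IsMcNaughton fun x => 1 - f x := by
  obtain ⟨hc, hI, u, p, hp, hfp⟩ := hf
  refine ⟨continuousOn_const.sub hc, fun x hx => ?_, u, fun j x => 1 - p j x,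
    fun j => (hp j).one_sub, fun x hx => ?_⟩
  · have := hI x hx
    exact ⟨by linarith [this.2], by linarith [this.1]⟩
  · obtain ⟨j, hj⟩ := hfp x hx
    exact ⟨j, congrArg (1 - ·) hj⟩

theorem IsMcNaughton.comp_index {m n : ℕ} {f : (Fin m → ℝ) → ℝ} (hf : IsMcNaughton f)
    (e : Fin m → Fin n) : IsMcNaughton fun x => f (x ∘ e) := by
  obtain ⟨hc, hI, u, p, hp, hfp⟩ := hf
  have hmaps : MapsTo (fun x : Fin n → ℝ => x ∘ e) (cube n) (cube m) := fun x hx =>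
    ⟨fun i => hx.1 (e i), fun i => hx.2 (e i)⟩
  have he : Continuous fun x : Fin n → ℝ => x ∘ e := by fun_prop
  exact ⟨hc.comp he.continuousOn hmaps, fun x hx => hI _ (hmaps hx), u,
    fun j x => p j (x ∘ e), fun j => (hp j).comp_index e, fun x hx => hfp _ (hmaps hx)⟩

theorem IsMcNaughton.oplus {n : ℕ} {f g : (Fin n → ℝ) → ℝ} (hf : IsMcNaughton f)
    (hg : IsMcNaughton g) : IsMcNaughton (mvOplus f g) := by
  obtain ⟨hc, hI, u, p, hp, hfp⟩ := hf
  obtain ⟨hc', hI', u', p', hp', hfp'⟩ := hg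
  refine .of_finite (κ := Option (Fin u × Fin u')) (continuousOn_const.inf (hc.add hc'))
    (fun x hx => ⟨le_min zero_le_one (add_nonneg (hI x hx).1 (hI' x hx).1), min_le_left _ _⟩)
    (fun o => o.elim (fun _ => ((1 : ℤ) : ℝ)) fun j x => p j.1 x + p' j.2 x) ?_ ?_
  · rintro (_ | ⟨i, j⟩)
    · exact .const 1
    · exact (hp i).add (hp' j)
  · intro x hx
    obtain ⟨i, hi⟩ := hfp x hx
    obtain ⟨j, hj⟩ := hfp' x hx
    rcases min_choice 1 (f x + g x) with hm | hm
    · exact ⟨none, by simpa [mvOplus] using hm⟩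
    · exact ⟨some (i, j), by simpa only [mvOplus, Option.elim, hi, hj] using hm⟩

variable {ι : Type*} {X : Set (ι → ℝ)}

theorem proj_mem_cube {m : ℕ} (e : Fin m → ι) {x : ι → ℝ} (hx : x ∈ cubeI ι) :
    (fun j => x (e j)) ∈ cube m :=
  ⟨fun j => hx.1 (e j), fun j => hx.2 (e j)⟩

theorem proj_mem_McNI (i : ι) : (fun x : X => x.1 i) ∈ McNI X :=
  ⟨fun x => x i, ⟨1, fun _ => i, fun y => y 0, .proj 0, fun _ _ => rfl⟩, fun _ => rfl⟩

theorem continuous_of_mem_McNI (hX : X ⊆ cubeI ι) {g : X → ℝ} (hg : g ∈ McNI X) :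
    Continuous g := by
  obtain ⟨F, ⟨m, e, f, hf, hFf⟩, hgF⟩ := hg
  have : g = fun x : X => f fun j => x.1 (e j) := funext fun x => by rw [hgF, hFf _ (hX x.2)]
  rw [this]
  exact hf.1.comp_continuous
    (continuous_pi fun j => (continuous_apply (e j)).comp continuous_subtype_val)
    fun x => proj_mem_cube e (hX x.2)

theorem isMVSubalgebra_McNI (hX : X ⊆ cubeI ι) : IsMVSubalgebra (McNI X) where
  zero_mem := ⟨fun _ => 0, ⟨0, Fin.elim0, fun _ => 0, .zero, fun _ _ => rfl⟩, fun _ => rfl⟩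
  neg_mem := by
    rintro g ⟨F, ⟨m, e, f, hf, hFf⟩, hgF⟩
    exact ⟨fun x => 1 - F x, ⟨m, e, _, hf.one_sub, fun x hx => congrArg (1 - ·) (hFf x hx)⟩,
      fun x => by simp only [mvNeg, hgF]⟩
  oplus_mem := by
    rintro g ⟨F, ⟨m, e, f, hf, hFf⟩, hgF⟩ g' ⟨F', ⟨m', e', f', hf', hFf'⟩, hgF'⟩
    refine ⟨mvOplus F F', ⟨m + m', Fin.append e e', _,
      (hf.comp_index (Fin.castAdd m')).oplus (hf'.comp_index (Fin.natAdd m)), fun x hx => ?_⟩,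
      fun x => by simp only [mvOplus, hgF, hgF']⟩
    simp only [mvOplus, hFf x hx, hFf' x hx, Function.comp_def, Fin.append_left, Fin.append_right]
  mem_Icc := by
    rintro g ⟨F, ⟨m, e, f, hf, hFf⟩, hgF⟩ x
    rw [hgF, hFf _ (hX x.2)]
    exact hf.2.1 _ (proj_mem_cube e (hX x.2))

/-- Every MV-endomorphism of `McNI X` is composition with a continuous self-map of `X`. -/
theorem IsMVEndoI.exists_continuous_comp [CompactSpace X] (hX : X ⊆ cubeI ι)
    {σ : (X → ℝ) → (X → ℝ)} (hσ : IsMVEndoI X σ) :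
    ∃ φ : X → X, Continuous φ ∧ ∀ f ∈ McNI X, ∀ x, σ f x = f (φ x) := by
  obtain ⟨hmaps, hzero, hneg, hoplus⟩ := hσ
  have hA := isMVSubalgebra_McNI hX
  have hchar : ∀ x, IsMVCharacter (McNI X) fun f => σ f x := fun x =>
    ⟨congrFun hzero x, fun f hf => congrFun (hneg f hf) x,
      fun f hf g hg => congrFun (hoplus f hf g hg) x, fun f hf => hA.mem_Icc _ (hmaps hf) x⟩
  choose φ hφ using fun x =>
    (hchar x).exists_eq_eval hA fun _ => continuous_of_mem_McNI hX
  refine ⟨φ, continuous_induced_rng.2 (continuous_pi fun i => ?_), fun f hf x => hφ x f hf⟩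
  have : (fun x => (Subtype.val ∘ φ) x i) = σ fun x => x.1 i :=
    funext fun x => (hφ x _ (proj_mem_McNI i)).symm
  rw [this]
  exact continuous_of_mem_McNI hX (hmaps (proj_mem_McNI i))

end McNaughton

/-- if `X ⊆ [0,1]^ι` is nonempty, closed (product topology) and a
topological manifold without boundary (each point has an open neighborhood in `X`
homeomorphic to `ℝ^k` for a fixed `k`), then `McN(X)` is hopfian. -/
theorem stmt10 {ι : Type*} (X : Set (ι → ℝ)) (hXc : X ⊆ cubeI ι)
    (hcl : IsClosed X) (hne : X.Nonempty) (k : ℕ)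
    (hman : ∀ x : ↥X, ∃ U : Set ↥X, IsOpen U ∧ x ∈ U ∧ Nonempty (↥U ≃ₜ (Fin k → ℝ))) :
    ∀ σ : (↥X → ℝ) → (↥X → ℝ), IsMVEndoI X σ →
      Set.SurjOn σ (McNI X) (McNI X) → Set.InjOn σ (McNI X) := by
  intro σ hσ hsurj
  have hcompact : CompactSpace X :=
    isCompact_iff_compactSpace.1 (isCompact_Icc.of_isClosed_subset hcl hXc)
  have hcharts : ∀ x : X, ∃ a : EuclideanSpace ℝ (Fin k) → X,
      Topology.IsOpenEmbedding a ∧ x ∈ range a := by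
    intro x
    obtain ⟨U, hU, hxU, ⟨e⟩⟩ := hman x
    let e' := (EuclideanSpace.equiv (Fin k) ℝ).toHomeomorph.trans e.symm
    exact ⟨Subtype.val ∘ e', hU.isOpenEmbedding_subtypeVal.comp e'.isOpenEmbedding,
      e'.symm ⟨x, hxU⟩, by simp⟩
  have := locallyConnectedSpace_of_isOpenEmbedding hcharts
  obtain ⟨φ, hφc, hφ⟩ := hσ.exists_continuous_comp hXc
  have hφinj : Function.Injective φ := by
    intro x y hxy
    refine Subtype.ext (funext fun i => ?_)
    obtain ⟨f, hf, hfi⟩ := hsurj (proj_mem_McNI (X := X) i)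
    rw [← congrFun hfi x, ← congrFun hfi y, hφ f hf, hφ f hf, hxy]
  have hφsurj := surjective_of_isOpenMap_isClosedMap hφc hφinj
    (isOpenMap_of_continuous_injective hcharts hcharts hφc hφinj) hφc.isClosedMap
  intro f hf g hg hfg
  funext y
  obtain ⟨x, rfl⟩ := hφsurj y
  rw [← hφ f hf, ← hφ g hg, hfg]
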